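/- For any real numbers φ and α satisfying φ = 0 and 0 < α < π/3, there exists a 2-special polygon P with angle parameters φ(P) = φ and α(P) = α; moreover, if P₁ is any other 2-special polygon with φ(P₁) = φ and α(P₁) = α, then P₁ is directly similar to P. -/

import Mathlib

open Real EuclideanGeometry

attribute [local instance] Complex.finrank_real_complex_fact

/-- The signed turning angle at the middle vertex `q` of the path `p → q → r`:
the oriented angle from the direction `q - p` to the direction `r - q`,
taken in `(-π, π]`. -/
noncomputable def turn (p q r : ℂ) : ℝ :=
  (Complex.orientation.oangle (q - p) (r - q)).toReal

/-- A cyclic sequence of vertices in the plane bounds a simple polygon: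
all edges are nondegenerate, consecutive edges meet exactly in their shared
vertex, and non-adjacent edges are disjoint. -/
def IsSimplePolygon {n : ℕ} [NeZero n] (v : Fin n → ℂ) : Prop :=
  (∀ i, v i ≠ v (i + 1)) ∧
  (∀ i : Fin n, segment ℝ (v i) (v (i + 1)) ∩ segment ℝ (v (i + 1)) (v (i + 2)) = {v (i + 1)}) ∧
  (∀ i j : Fin n, j ≠ i → j ≠ i + 1 → j + 1 ≠ i →
    segment ℝ (v i) (v (i + 1)) ∩ segment ℝ (v j) (v (j + 1)) = ∅)

/-- A simple polygon is positively (counterclockwisely) oriented when the sum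
of its signed turning angles is `2π`. -/
def IsCCW {n : ℕ} [NeZero n] (v : Fin n → ℂ) : Prop :=
  ∑ i : Fin n, turn (v (i - 1)) (v i) (v (i + 1)) = 2 * π

/-- The interior angle of a counterclockwisely ordered simple polygon at its
`i`-th vertex: `π` minus the signed turning angle there.  It may exceed `π`
(at reflex vertices). -/
noncomputable def intAngle {n : ℕ} [NeZero n] (v : Fin n → ℂ) (i : Fin n) : ℝ :=
  π - turn (v (i - 1)) (v i) (v (i + 1))

/-- A 2-special polygon: a simple quadrilateral with counterclockwise vertices
`a, c', d, c''` whose interior angle at `a` is `4π/3`, whose interior angles at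
`c'` and `c''` are less than `π`, whose interior angle at `d` is `π/3`, and with
`c'`, `d`, `c''` equidistant from `a`. -/
def Is2Special (a c' d c'' : ℂ) : Prop :=
  IsSimplePolygon ![a, c', d, c''] ∧ IsCCW ![a, c', d, c''] ∧
  intAngle ![a, c', d, c''] 0 = 4 * π / 3 ∧
  intAngle ![a, c', d, c''] 1 < π ∧
  intAngle ![a, c', d, c''] 3 < π ∧
  intAngle ![a, c', d, c''] 2 = π / 3 ∧
  dist a c' = dist a d ∧ dist a d = dist a c''

/-- A 3-special polygon: a simple pentagon with counterclockwise vertices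
`a, c', e', e'', c''` whose interior angle at `a` is `4π/3`, all other interior
angles being less than `π`, with interior angles `π/3` at `c'` and `c''`,
`dist a c' = dist a c''`, sides `c'e'` and `c''e''` parallel and of equal
length, and interior angles `π/2` at `e'` and `e''`. -/
def Is3Special (a c' e' e'' c'' : ℂ) : Prop :=
  IsSimplePolygon ![a, c', e', e'', c''] ∧ IsCCW ![a, c', e', e'', c''] ∧
  intAngle ![a, c', e', e'', c''] 0 = 4 * π / 3 ∧
  (∀ i : Fin 5, i ≠ 0 → intAngle ![a, c', e', e'', c''] i < π) ∧
  intAngle ![a, c', e', e'', c''] 1 = π / 3 ∧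
  intAngle ![a, c', e', e'', c''] 4 = π / 3 ∧
  dist a c' = dist a c'' ∧
  (∃ r : ℝ, e'' - c'' = r • (e' - c')) ∧
  dist c' e' = dist c'' e'' ∧
  intAngle ![a, c', e', e'', c''] 2 = π / 2 ∧
  intAngle ![a, c', e', e'', c''] 3 = π / 2

/-- A 4-special polygon: a simple hexagon with counterclockwise vertices
`a, c', e', f', e'', c''` whose interior angle at `a` is `4π/3`, all other
interior angles being less than `π`, with interior angles `π/3` at `c'` and
`c''`, `dist a c' = dist a c''`, sides `c'e'` and `c''e''` parallel and of
equal length, and `e'`, `f'`, `e''` equidistant from `a`. -/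
def Is4Special (a c' e' f' e'' c'' : ℂ) : Prop :=
  IsSimplePolygon ![a, c', e', f', e'', c''] ∧ IsCCW ![a, c', e', f', e'', c''] ∧
  intAngle ![a, c', e', f', e'', c''] 0 = 4 * π / 3 ∧
  (∀ i : Fin 6, i ≠ 0 → intAngle ![a, c', e', f', e'', c''] i < π) ∧
  intAngle ![a, c', e', f', e'', c''] 1 = π / 3 ∧
  intAngle ![a, c', e', f', e'', c''] 5 = π / 3 ∧
  dist a c' = dist a c'' ∧
  (∃ r : ℝ, e'' - c'' = r • (e' - c')) ∧
  dist c' e' = dist c'' e'' ∧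
  dist a e' = dist a f' ∧ dist a f' = dist a e''

lemma turn_eq (p q r : ℂ) :
    turn p q r = Complex.arg ((starRingEnd ℂ) (q - p) * (r - q)) := by
  rw [turn, Complex.oangle, Complex.arg_coe_angle_toReal_eq_arg]

lemma turn_of (p q r : ℂ) (ρ θ : ℝ) (hρ : 0 < ρ) (h1 : -π < θ) (h2 : θ ≤ π)
    (hre : ((starRingEnd ℂ) (q - p) * (r - q)).re = ρ * Real.cos θ)
    (him : ((starRingEnd ℂ) (q - p) * (r - q)).im = ρ * Real.sin θ) :
    turn p q r = θ := by
  rw [turn_eq, ← Complex.arg_mul_cos_add_sin_mul_I hρ ⟨h1, h2⟩]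
  congr 1
  apply Complex.ext
  · rw [hre, ← Complex.ofReal_cos, ← Complex.ofReal_sin]; simp [-Complex.ofReal_cos, -Complex.ofReal_sin]
  · rw [him, ← Complex.ofReal_cos, ← Complex.ofReal_sin]; simp [-Complex.ofReal_cos, -Complex.ofReal_sin]

lemma mem_seg {A B x : ℂ} (h : x ∈ segment ℝ A B) :
    ∃ t : ℝ, 0 ≤ t ∧ t ≤ 1 ∧ x.re = A.re + t * (B.re - A.re) ∧
      x.im = A.im + t * (B.im - A.im) := by
  rw [segment_eq_image'] at h
  obtain ⟨t, ⟨h0, h1⟩, rfl⟩ := h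
  exact ⟨t, h0, h1, by simp, by simp⟩

lemma seg_inter {A B C : ℂ}
    (h : ∀ x, x ∈ segment ℝ A B → x ∈ segment ℝ B C → x = B) :
    segment ℝ A B ∩ segment ℝ B C = {B} := by
  apply Set.eq_singleton_iff_unique_mem.2
  exact ⟨⟨right_mem_segment ℝ A B, left_mem_segment ℝ B C⟩, fun x hx => h x hx.1 hx.2⟩

lemma seg_a {p : ℂ} (hp : p.im ≠ 0) (x : ℂ) (h1 : x ∈ segment ℝ 0 p)
    (h2 : x ∈ segment ℝ p 1) : x = p := by
  obtain ⟨t, -, -, tr, ti⟩ := mem_seg h1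
  obtain ⟨s, -, -, sr, si⟩ := mem_seg h2
  simp only [Complex.zero_re, Complex.zero_im, Complex.one_re, Complex.one_im] at *
  have h : t = 1 - s := by
    apply mul_right_cancel₀ hp; linarith
  subst h
  have hs : s = 0 := by nlinarith
  subst hs
  apply Complex.ext <;> linarith

/-- A point on an edge issuing from a real point is that point or is off the axis. -/
lemma seg_im {A p x : ℂ} (hA : A.im = 0) (h : x ∈ segment ℝ A p) :
    x = A ∨ 0 < x.im * p.im ∨ p.im = 0 := by
  obtain ⟨t, t0, -, tr, ti⟩ := mem_seg h
  rcases eq_or_lt_of_le t0 with rfl | ht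
  · left; apply Complex.ext <;> linarith
  · right
    by_cases hp : p.im = 0
    · exact Or.inr hp
    · left
      have : x.im * p.im = t * (p.im * p.im) := by rw [ti, hA]; ring
      rw [this]
      exact mul_pos ht (mul_self_pos.2 hp)

lemma seg_b {A B p q x : ℂ} (hA : A.im = 0) (hB : B.im = 0) (hp : p.im < 0) (hq : 0 < q.im)
    (h1 : x ∈ segment ℝ A p) (h2 : x ∈ segment ℝ B q) : x = A ∧ x = B := by
  rcases seg_im hA h1 with h1 | h1 | h1
  · rcases seg_im hB h2 with h2 | h2 | h2
    · exact ⟨h1, h2⟩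
    · rw [h1, hA] at h2; simp at h2
    · linarith
  · rcases seg_im hB h2 with h2 | h2 | h2
    · rw [h2, hB] at h1; simp at h1
    · exfalso
      have := neg_of_mul_pos_left h1 hp.le
      have := pos_of_mul_pos_left h2 hq.le
      linarith
    · linarith
  · linarith

lemma simple_model {p q : ℂ} (hp : p.im < 0) (hq : 0 < q.im) :
    IsSimplePolygon ![0, p, 1, q] := by
  have hp0 : p ≠ 0 := by rintro rfl; simp at hp
  have hq0 : q ≠ 0 := by rintro rfl; simp at hq
  have hp1 : p ≠ 1 := by rintro rfl; simp at hp
  have hq1 : q ≠ 1 := by rintro rfl; simp at hq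
  have e1 : segment ℝ 0 p ∩ segment ℝ p 1 = {p} := seg_inter (seg_a hp.ne)
  have e2 : segment ℝ p 1 ∩ segment ℝ 1 q = {1} := seg_inter fun x h1 h2 =>
    (seg_b (A := 1) (B := 1) (by simp) (by simp) hp hq (segment_symm ℝ p 1 ▸ h1) h2).1
  have e3 : segment ℝ 1 q ∩ segment ℝ q 0 = {q} := seg_inter fun x h1 h2 =>
    seg_a hq.ne' x (segment_symm ℝ q 0 ▸ h2) (segment_symm ℝ 1 q ▸ h1)
  have e4 : segment ℝ q 0 ∩ segment ℝ 0 p = {0} := seg_inter fun x h1 h2 =>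
    (seg_b (A := 0) (B := 0) (by simp) (by simp) hp hq h2 (segment_symm ℝ q 0 ▸ h1)).1
  have f1 : segment ℝ 0 p ∩ segment ℝ 1 q = ∅ := by
    apply Set.eq_empty_of_forall_notMem
    rintro x ⟨h1, h2⟩
    obtain ⟨h, h'⟩ := seg_b (A := 0) (B := 1) (by simp) (by simp) hp hq h1 h2
    exact zero_ne_one (h.symm.trans h')
  have f2 : segment ℝ p 1 ∩ segment ℝ q 0 = ∅ := by
    apply Set.eq_empty_of_forall_notMem
    rintro x ⟨h1, h2⟩
    obtain ⟨h, h'⟩ := seg_b (A := 1) (B := 0) (by simp) (by simp) hp hq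
      (segment_symm ℝ p 1 ▸ h1) (segment_symm ℝ q 0 ▸ h2)
    exact zero_ne_one (h'.symm.trans h)
  refine ⟨?_, ?_, ?_⟩
  · intro i
    fin_cases i
    · exact hp0.symm
    · exact hp1
    · exact hq1.symm
    · exact hq0
  · intro i
    fin_cases i
    · exact e1
    · exact e2
    · exact e3
    · exact e4
  · intro i j h1 h2 h3
    have h : j = i + 2 := by revert i j; decide
    subst h
    clear h1 h2 h3
    fin_cases i
    · exact f1
    · exact f2
    · exact (Set.inter_comm _ _).trans f1
    · exact (Set.inter_comm _ _).trans f2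

lemma model_special (α : ℝ) (h0 : 0 < α) (h1 : α < π / 3) :
    ∃ p q : ℂ, Is2Special 0 p 1 q ∧ EuclideanGeometry.angle 0 p 1 = α := by
  obtain ⟨β, hβ⟩ : ∃ β, β = π / 3 - α := ⟨_, rfl⟩
  have hπ := Real.pi_pos
  have hC : 0 < Real.cos α := Real.cos_pos_of_mem_Ioo ⟨by linarith, by linarith⟩
  have hD : 0 < Real.cos β := Real.cos_pos_of_mem_Ioo ⟨by linarith, by linarith⟩
  have hS : 0 < Real.sin α := Real.sin_pos_of_pos_of_lt_pi h0 (by linarith)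
  have hT : 0 < Real.sin β := Real.sin_pos_of_pos_of_lt_pi (by linarith) (by linarith)
  have hCS := Real.sin_sq_add_cos_sq α
  have hDT := Real.sin_sq_add_cos_sq β
  have t0a : Real.cos (-π / 3) = -(Real.cos (2 * α) * Real.cos (2 * β)
      - Real.sin (2 * α) * Real.sin (2 * β)) := by
    rw [← Real.cos_add, ← Real.cos_sub_pi]; congr 1; rw [hβ]; ring
  have t0b : Real.sin (-π / 3) = -(Real.sin (2 * α) * Real.cos (2 * β)
      + Real.cos (2 * α) * Real.sin (2 * β)) := by
    rw [← Real.sin_add, ← Real.sin_sub_pi]; congr 1; rw [hβ]; ring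
  have t2a : Real.cos (2 * π / 3) = -(Real.cos α * Real.cos β - Real.sin α * Real.sin β) := by
    rw [← Real.cos_add, ← Real.cos_pi_sub]; congr 1; rw [hβ]; ring
  have t2b : Real.sin (2 * π / 3) = Real.sin α * Real.cos β + Real.cos α * Real.sin β := by
    rw [← Real.sin_add, ← Real.sin_pi_sub]; congr 1; rw [hβ]; ring
  have d1 := Real.cos_two_mul α
  have d2 := Real.cos_two_mul β
  have d3 := Real.sin_two_mul α
  have d4 := Real.sin_two_mul β
  have t1a := Real.cos_pi_sub α
  have t1b := Real.sin_pi_sub α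
  have t3a := Real.cos_pi_sub β
  have t3b := Real.sin_pi_sub β
  set C := Real.cos α
  set S := Real.sin α
  set D := Real.cos β
  set T := Real.sin β
  rw [d1, d2, d3, d4] at t0a t0b
  obtain ⟨p, hp⟩ : ∃ p : ℂ, p = ⟨1 - 2 * C ^ 2, -(2 * S * C)⟩ := ⟨_, rfl⟩
  obtain ⟨q, hq⟩ : ∃ q : ℂ, q = ⟨1 - 2 * D ^ 2, 2 * T * D⟩ := ⟨_, rfl⟩
  have pr : p.re = 1 - 2 * C ^ 2 := by rw [hp]
  have pim : p.im = -(2 * S * C) := by rw [hp]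
  have qr : q.re = 1 - 2 * D ^ 2 := by rw [hq]
  have qim : q.im = 2 * T * D := by rw [hq]
  have hS2 : S ^ 2 = 1 - C ^ 2 := by linarith
  have hT2 : T ^ 2 = 1 - D ^ 2 := by linarith
  have np : ‖p‖ = 1 := by
    rw [Complex.norm_def, Complex.normSq_apply, pr, pim, Real.sqrt_eq_one]
    linear_combination (4 * C ^ 2) * hS2
  have nq : ‖q‖ = 1 := by
    rw [Complex.norm_def, Complex.normSq_apply, qr, qim, Real.sqrt_eq_one]
    linear_combination (4 * D ^ 2) * hT2
  have T0 : turn q 0 p = -π / 3 := by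
    apply turn_of q 0 p 1 _ one_pos (by linarith) (by linarith)
    · rw [t0a]; simp [pr, pim, qr, qim]; ring
    · rw [t0b]; simp [pr, pim, qr, qim]; ring
  have T1 : turn 0 p 1 = π - α := by
    apply turn_of 0 p 1 (2 * C) _ (by positivity) (by linarith) (by linarith)
    · rw [t1a]; simp [pr, pim]; linear_combination (-4 * C ^ 2) * hS2
    · rw [t1b]; simp [pr, pim]; ring
  have T2 : turn p 1 q = 2 * π / 3 := by
    apply turn_of p 1 q (4 * C * D) _ (by positivity) (by linarith) (by linarith)
    · rw [t2a]; simp [pr, pim, qr, qim]; ring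
    · rw [t2b]; simp [pr, pim, qr, qim]; ring
  have T3 : turn 1 q 0 = π - β := by
    apply turn_of 1 q 0 (2 * D) _ (by positivity) (by linarith) (by linarith)
    · rw [t3a]; simp [qr, qim]; linear_combination (-4 * D ^ 2) * hT2
    · rw [t3b]; simp [qr, qim]; ring
  refine ⟨p, q, ⟨?_, ?_, ?_, ?_, ?_, ?_, ?_, ?_⟩, ?_⟩
  · apply simple_model
    · rw [pim]; have := mul_pos hS hC; linarith
    · rw [qim]; positivity
  · rw [IsCCW, Fin.sum_univ_four]
    change turn q 0 p + turn 0 p 1 + turn p 1 q + turn 1 q 0 = 2 * π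
    rw [T0, T1, T2, T3, hβ]; ring
  · change π - turn q 0 p = _
    rw [T0]; ring
  · change π - turn 0 p 1 < _
    rw [T1]; linarith
  · change π - turn 1 q 0 < _
    rw [T3]; linarith
  · change π - turn p 1 q = _
    rw [T2]; ring
  · simp [np]
  · simp [nq]
  · rw [EuclideanGeometry.angle, InnerProductGeometry.angle]
    have hn : ‖(1 : ℂ) - p‖ = 2 * C := by
      rw [Complex.norm_def, Complex.normSq_apply]
      simp only [Complex.sub_re, Complex.sub_im, Complex.one_re, Complex.one_im, pr, pim]
      rw [Real.sqrt_eq_iff_mul_self_eq_of_pos (by positivity)]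
      linear_combination (-4 * C ^ 2) * hS2
    have hi : inner ℝ (0 - p) (1 - p) = 2 * C * C := by
      rw [Complex.inner]; simp [pr, pim]; linear_combination (4 * C ^ 2) * hS2
    simp only [vsub_eq_sub]
    rw [hi, hn, zero_sub, norm_neg, np]
    rw [show 2 * C * C / (1 * (2 * C)) = C by field_simp]
    exact Real.arccos_cos h0.le (by linarith)

lemma special_key (α : ℝ) (h0 : 0 < α) (h1 : α < π / 3) (a p d q : ℂ)
    (h : Is2Special a p d q) (hα : EuclideanGeometry.angle a p d = α) :
    d - a ≠ 0 ∧
      p - a = (d - a) * ⟨1 - 2 * Real.cos α ^ 2, -(2 * Real.sin α * Real.cos α)⟩ ∧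
      q - a = -(Complex.exp (((π / 3 : ℝ) : ℂ) * Complex.I)) * (p - a) := by
  obtain ⟨⟨hne, -, -⟩, -, i0, i1, -, -, e1, e2⟩ := h
  have hap : a ≠ p := hne 0
  have hpd : p ≠ d := hne 1
  change π - turn q a p = _ at i0
  change π - turn a p d < _ at i1
  have hπ := Real.pi_pos
  have hC : 0 < Real.cos α := Real.cos_pos_of_mem_Ioo ⟨by linarith, by linarith⟩
  have hS : 0 < Real.sin α := Real.sin_pos_of_pos_of_lt_pi h0 (by linarith)
  have hCS := Real.sin_sq_add_cos_sq α
  have hD : d - a ≠ 0 := by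
    intro hd
    have : d = a := sub_eq_zero.1 hd
    rw [this, dist_self, dist_eq_zero] at e1
    exact hap e1
  refine ⟨hD, ?_, ?_⟩
  · obtain ⟨z, hz⟩ : ∃ z, p - a = (d - a) * z := ⟨(p - a) / (d - a), by field_simp⟩
    rw [hz]
    congr 1
    have hpz : p = a + (d - a) * z := by rw [← hz]; ring
    have nz : ‖z‖ = 1 := by
      have h2 : ‖p - a‖ = ‖d - a‖ := by
        rw [← dist_eq_norm, ← dist_eq_norm, dist_comm p a, dist_comm d a]; exact e1
      rw [hz, norm_mul] at h2
      exact mul_left_cancel₀ (norm_ne_zero_iff.2 hD) (by rw [h2, mul_one])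
    have hxy : z.re ^ 2 + z.im ^ 2 = 1 := by
      have := Complex.sq_norm z
      rw [nz, Complex.normSq_apply] at this
      linarith
    have hz1 : z.re ≠ 1 := by
      intro hx
      have hy : z.im = 0 := by
        rw [hx] at hxy; nlinarith
      apply hpd
      have : z = 1 := Complex.ext hx hy
      rw [hpz, this]; ring
    have hang : InnerProductGeometry.angle (-z) (1 - z) = α := by
      rw [← hα, EuclideanGeometry.angle, ← Complex.angle_mul_left hD]
      congr 1
      · rw [vsub_eq_sub, hpz]; ring
      · rw [vsub_eq_sub, hpz]; ring
    have hin := InnerProductGeometry.cos_angle_mul_norm_mul_norm (-z) (1 - z)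
    rw [hang, norm_neg, nz, one_mul, Complex.inner] at hin
    have hr : ((1 - z) * (starRingEnd ℂ) (-z)).re = 1 - z.re := by
      simp; linear_combination hxy
    rw [hr] at hin
    have hN := Complex.sq_norm (1 - z)
    rw [Complex.normSq_apply] at hN
    simp only [Complex.sub_re, Complex.sub_im, Complex.one_re, Complex.one_im] at hN
    have hx : z.re = 1 - 2 * Real.cos α ^ 2 := by
      have h3 : (1 - z.re) * (1 - z.re) = (1 - z.re) * (2 * Real.cos α ^ 2) := by
        nth_rewrite 1 2 [← hin]
        linear_combination Real.cos α ^ 2 * hN + Real.cos α ^ 2 * hxy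
      have := mul_left_cancel₀ (sub_ne_zero.2 hz1.symm) h3
      linarith
    have hy0 : z.im ≤ 0 := by
      have ht : 0 ≤ turn a p d := by linarith
      rw [turn_eq, Complex.arg_nonneg_iff] at ht
      have h4 : (starRingEnd ℂ) (p - a) * (d - p)
          = ((Complex.normSq (d - a) : ℝ) : ℂ) * ((starRingEnd ℂ) z * (1 - z)) := by
        rw [hz, Complex.normSq_eq_conj_mul_self, map_mul, hpz]; ring
      rw [h4, Complex.im_ofReal_mul] at ht
      have h5 := nonneg_of_mul_nonneg_right ht (Complex.normSq_pos.2 hD)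
      simp at h5
      nlinarith
    have hy : z.im = -(2 * Real.sin α * Real.cos α) := by
      have h6 : (-z.im) ^ 2 = (2 * Real.sin α * Real.cos α) ^ 2 := by
        rw [hx] at hxy
        linear_combination hxy - 4 * Real.cos α ^ 2 * hCS
      have := (sq_eq_sq₀ (by linarith) (by positivity)).1 h6
      linarith
    exact Complex.ext hx hy
  · have ht : turn q a p = -(π / 3) := by linarith
    rw [turn_eq] at ht
    have h7 := Complex.norm_mul_exp_arg_mul_I ((starRingEnd ℂ) (a - q) * (p - a))
    have hpa : ‖p - a‖ = ‖a - q‖ := by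
      rw [← dist_eq_norm, ← dist_eq_norm, dist_comm p a]; exact e1.trans e2
    rw [ht, norm_mul, Complex.norm_conj, hpa] at h7
    have hq0 : a - q ≠ 0 := by
      rw [← norm_ne_zero_iff, ← hpa, norm_ne_zero_iff]
      exact sub_ne_zero.2 hap.symm
    have h8 : ((‖a - q‖ * ‖a - q‖ : ℝ) : ℂ) = (starRingEnd ℂ) (a - q) * (a - q) := by
      rw [← Complex.normSq_eq_conj_mul_self, Complex.normSq_eq_norm_sq, sq]
    rw [h8, mul_assoc] at h7
    have h9 := mul_left_cancel₀ ((map_ne_zero _).2 hq0) h7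
    rw [← h9]
    have h10 : Complex.exp (((π / 3 : ℝ) : ℂ) * Complex.I)
        * Complex.exp (((-(π / 3) : ℝ) : ℂ) * Complex.I) = 1 := by
      rw [← Complex.exp_add]
      simp
    linear_combination (-(q - a)) * h10

/-- For any `φ, α` with `φ = 0` and `0 < α < π/3` there is a 2-special polygon
with angle parameters `φ` and `α`, and any other 2-special polygon with the
same angle parameters is directly similar to it (an orientation-preserving
similarity of the plane `z ↦ s·z + t`, `s ≠ 0`, carries corresponding vertices
to each other). -/
theorem two_special_exists_unique (φ α : ℝ)
    (hφ : φ = 0) (hα₀ : 0 < α) (hα₁ : α < π / 3) :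
    ∃ a c' d c'' : ℂ, Is2Special a c' d c'' ∧
      EuclideanGeometry.angle a c' d = α ∧
      ∀ a₁ c₁' d₁ c₁'' : ℂ, Is2Special a₁ c₁' d₁ c₁'' →
        EuclideanGeometry.angle a₁ c₁' d₁ = α →
        ∃ s t : ℂ, s ≠ 0 ∧ a₁ = s * a + t ∧ c₁' = s * c' + t ∧ d₁ = s * d + t ∧
          c₁'' = s * c'' + t := by
  obtain ⟨p, q, hs, ha⟩ := model_special α hα₀ hα₁
  refine ⟨0, p, 1, q, hs, ha, ?_⟩
  obtain ⟨-, m1, m2⟩ := special_key α hα₀ hα₁ _ _ _ _ hs ha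
  intro a₁ p₁ d₁ q₁ hs₁ ha₁
  obtain ⟨hD, n1, n2⟩ := special_key α hα₀ hα₁ _ _ _ _ hs₁ ha₁
  simp only [sub_zero, one_mul] at m1 m2
  rw [← m1] at n1
  refine ⟨d₁ - a₁, a₁, hD, by ring, ?_, by ring, ?_⟩
  · linear_combination n1
  · rw [m2]
    linear_combination n2 - Complex.exp (((π / 3 : ℝ) : ℂ) * Complex.I) * n1
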